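/- arXiv:1701.00858 — 2 statements merged into one kernel-verified Lean document; each statement's English description precedes it below -/
import Mathlib

section
/- Parametric free-energy difference formula for the rank-one Bayes-optimal problem: let P be a compactly supported probability measure on ℝ. Define f^{SE}(y) = E over x₀ ~ P and W of [ x₀ · f_in( y, y·x₀ + √y·W ) ] for y ≥ 0, and for m ≥ 0, Δ > 0 define Φ(m, Δ) = E over x₀ ~ P and W of [ log Z( m/Δ, (m/Δ)·x₀ + √(m/Δ)·W ) ] − m²/(4Δ). Then for every x > 0 with f^{SE}(x) > 0, setting Δ(x) = f^{SE}(x)/x and m(x) = f^{SE}(x), one has Φ( m(x), Δ(x) ) − Φ( 0, Δ(x) ) = (1/2)·[ ∫₀ˣ f^{SE}(u) du − x·f^{SE}(x)/2 ]. -/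
open MeasureTheory ProbabilityTheory

/-- `Z(A,B) = ∫ exp(B·x − A·x²/2) dP(x)`. -/
noncomputable def Zfun (P : Measure ℝ) (A B : ℝ) : ℝ :=
  ∫ x, Real.exp (B * x - A * x ^ 2 / 2) ∂P

/-- `f_in(A,B) = (∫ x·exp(B·x − A·x²/2) dP(x)) / Z(A,B)`. -/
noncomputable def fIn (P : Measure ℝ) (A B : ℝ) : ℝ :=
  (∫ x, x * Real.exp (B * x - A * x ^ 2 / 2) ∂P) / Zfun P A B

/-- `f^{SE}(y) = E_{x₀ ∼ P, W}[ x₀ · f_in(y, y·x₀ + √y·W) ]`. -/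
noncomputable def fSE (P : Measure ℝ) (y : ℝ) : ℝ :=
  ∫ x₀, ∫ w, x₀ * fIn P y (y * x₀ + Real.sqrt y * w) ∂(gaussianReal 0 1) ∂P

/-- The rank-one Bayes-optimal replica free energy
`Φ(m, Δ) = E_{x₀, W}[ log Z(m/Δ, (m/Δ)x₀ + √(m/Δ)·W) ] − m²/(4Δ)`. -/
noncomputable def replicaPhi (P : Measure ℝ) (m Δ : ℝ) : ℝ :=
  (∫ x₀, ∫ w, Real.log (Zfun P (m / Δ) ((m / Δ) * x₀ + Real.sqrt (m / Δ) * w))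
      ∂(gaussianReal 0 1) ∂P) - m ^ 2 / (4 * Δ)

/-- The unnormalised `k`-th moment of the tilted measure, `∫ xᵏ·exp(B·x − A·x²/2) dP(x)`. -/
noncomputable def tiltedMoment (P : Measure ℝ) (k : ℕ) (A B : ℝ) : ℝ :=
  ∫ x, x ^ k * Real.exp (B * x - A * x ^ 2 / 2) ∂P

section Gaussian

lemma integrable_gaussianReal_iff {f : ℝ → ℝ} :
    Integrable f (gaussianReal 0 1) ↔ Integrable (fun w => f w * gaussianPDFReal 0 1 w) := by
  rw [gaussianReal_of_var_ne_zero 0 one_ne_zero,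
    integrable_withDensity_iff_integrable_smul' (measurable_gaussianPDF _ _)
      (ae_of_all _ fun _ => gaussianPDF_lt_top)]
  simp only [toReal_gaussianPDF, smul_eq_mul, mul_comm]

lemma hasDerivAt_gaussianPDFReal_zero_one (w : ℝ) :
    HasDerivAt (gaussianPDFReal 0 1) (-w * gaussianPDFReal 0 1 w) w := by
  have h : HasDerivAt (fun w : ℝ => -(w - 0) ^ 2 / (2 * ((1 : NNReal) : ℝ))) (-w) w := by
    have := (((hasDerivAt_id w).sub_const 0).pow 2).neg.div_const (2 * ((1 : NNReal) : ℝ))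
    refine this.congr_deriv ?_
    simp
    ring
  have := h.exp.const_mul (√(2 * Real.pi * ((1 : NNReal) : ℝ)))⁻¹
  refine this.congr_deriv ?_
  simp only [gaussianPDFReal]
  ring

/-- Stein's identity for the standard Gaussian. -/
lemma integral_id_mul_gaussianReal {f f' : ℝ → ℝ} (hf : ∀ w, HasDerivAt f (f' w) w)
    (h : Integrable f (gaussianReal 0 1)) (h' : Integrable f' (gaussianReal 0 1))
    (hw : Integrable (fun w => w * f w) (gaussianReal 0 1)) :
    ∫ w, w * f w ∂(gaussianReal 0 1) = ∫ w, f' w ∂(gaussianReal 0 1) := by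
  rw [integrable_gaussianReal_iff] at h h' hw
  have key := integral_mul_deriv_eq_deriv_mul_of_integrable (u := f) (u' := f')
    (v := gaussianPDFReal 0 1) (v' := fun w => -w * gaussianPDFReal 0 1 w)
    (fun w _ => hf w) (fun w _ => hasDerivAt_gaussianPDFReal_zero_one w)
    (hw.neg.congr (ae_of_all _ fun w => by simp only [Pi.neg_apply, Pi.mul_apply]; ring)) h' h
  simp only [integral_gaussianReal_eq_integral_smul one_ne_zero, smul_eq_mul]
  have e1 : ∫ w, gaussianPDFReal 0 1 w * (w * f w)
      = -∫ w, f w * (-w * gaussianPDFReal 0 1 w) := by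
    rw [← integral_neg]
    exact integral_congr_ae (ae_of_all _ fun w => by ring)
  rw [e1, key, neg_neg]
  exact integral_congr_ae (ae_of_all _ fun w => mul_comm _ _)

/-- The Cameron–Martin shift for the standard Gaussian. -/
lemma integral_comp_add_gaussianReal (h : ℝ → ℝ) (a : ℝ) :
    ∫ w, h (w + a) ∂(gaussianReal 0 1)
      = ∫ w, h w * Real.exp (a * w - a ^ 2 / 2) ∂(gaussianReal 0 1) := by
  simp only [integral_gaussianReal_eq_integral_smul one_ne_zero, smul_eq_mul]
  rw [← integral_add_right_eq_self (μ := volume)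
    (fun w => gaussianPDFReal 0 1 w * (h w * Real.exp (a * w - a ^ 2 / 2))) a]
  refine integral_congr_ae (ae_of_all _ fun w => ?_)
  have : Real.exp (-(w - 0) ^ 2 / (2 * ((1 : NNReal) : ℝ)))
      = Real.exp (-(w + a - 0) ^ 2 / (2 * ((1 : NNReal) : ℝ)))
        * Real.exp (a * (w + a) - a ^ 2 / 2) := by
    rw [← Real.exp_add]
    congr 1
    push_cast
    ring
  simp only [gaussianPDFReal, this]
  ring

lemma integrable_exp_mul_abs_gaussianReal (c : ℝ) :
    Integrable (fun w => Real.exp (c * |w|)) (gaussianReal 0 1) :=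
  integrable_exp_mul_abs (X := fun w : ℝ => w) (integrable_exp_mul_gaussianReal c)
    (integrable_exp_mul_gaussianReal (-c))

lemma Continuous.integrable_gaussianReal_of_abs_le {f : ℝ → ℝ} (hf : Continuous f) {C c : ℝ}
    (h : ∀ w, |f w| ≤ C * Real.exp (c * |w|)) : Integrable f (gaussianReal 0 1) :=
  ((integrable_exp_mul_abs_gaussianReal c).const_mul C).mono' hf.aestronglyMeasurable
    (ae_of_all _ h)

end Gaussian

section Moments

variable {P : Measure ℝ} [IsProbabilityMeasure P] {R : ℝ}

lemma Zfun_eq_tiltedMoment (P : Measure ℝ) (A B : ℝ) : Zfun P A B = tiltedMoment P 0 A B := by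
  simp [Zfun, tiltedMoment]

lemma fIn_eq_tiltedMoment (P : Measure ℝ) (A B : ℝ) :
    fIn P A B = tiltedMoment P 1 A B / tiltedMoment P 0 A B := by
  simp [fIn, Zfun_eq_tiltedMoment, tiltedMoment]

lemma abs_pow_mul_exp_le {x : ℝ} (hx : |x| ≤ R) (k : ℕ) (A B : ℝ) :
    |x ^ k * Real.exp (B * x - A * x ^ 2 / 2)|
      ≤ R ^ k * Real.exp (R * |B| + |A| * R ^ 2 / 2) := by
  have hx2 : x ^ 2 ≤ R ^ 2 := sq_le_sq.2 (hx.trans (le_abs_self R))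
  have h1 : B * x ≤ R * |B| := by
    calc B * x ≤ |B| * |x| := (le_abs_self _).trans (abs_mul _ _).le
      _ ≤ R * |B| := by rw [mul_comm]; gcongr
  have h2 : -(A * x ^ 2) ≤ |A| * R ^ 2 := by
    calc -(A * x ^ 2) = -A * x ^ 2 := by ring
      _ ≤ |A| * x ^ 2 := by gcongr; exact neg_le_abs A
      _ ≤ |A| * R ^ 2 := by gcongr
  have hR : 0 ≤ R := (abs_nonneg x).trans hx
  rw [abs_mul, abs_pow, Real.abs_exp]
  gcongr
  linarith

lemma exp_tilt_le {x : ℝ} (hx : |x| ≤ R) {A : ℝ} (hA : 0 ≤ A) (B : ℝ) :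
    Real.exp (B * x - A * x ^ 2 / 2) ≤ Real.exp (R * |B|) := by
  have h1 : B * x ≤ R * |B| := by
    calc B * x ≤ |B| * |x| := (le_abs_self _).trans (abs_mul _ _).le
      _ ≤ R * |B| := by rw [mul_comm]; gcongr
  have : 0 ≤ A * x ^ 2 := by positivity
  gcongr
  linarith

lemma integrable_tilt (hR : ∀ᵐ x ∂P, |x| ≤ R) (k : ℕ) (A B : ℝ) :
    Integrable (fun x => x ^ k * Real.exp (B * x - A * x ^ 2 / 2)) P :=
  (integrable_const (R ^ k * Real.exp (R * |B| + |A| * R ^ 2 / 2))).mono'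
    (by fun_prop) (hR.mono fun _ hx => abs_pow_mul_exp_le hx k A B)

lemma tiltedMoment_zero_pos (hR : ∀ᵐ x ∂P, |x| ≤ R) (A B : ℝ) : 0 < tiltedMoment P 0 A B := by
  have := integrable_tilt hR 0 A B
  simp only [pow_zero, one_mul] at this
  simpa [tiltedMoment] using integral_exp_pos this

lemma abs_tiltedMoment_le (hR : ∀ᵐ x ∂P, |x| ≤ R) (k : ℕ) (A B : ℝ) :
    |tiltedMoment P k A B| ≤ R ^ k * tiltedMoment P 0 A B := by
  rw [tiltedMoment, tiltedMoment, ← integral_const_mul]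
  refine (abs_integral_le_integral_abs).trans
    (integral_mono_ae (integrable_tilt hR k A B).abs ((integrable_tilt hR 0 A B).const_mul _) ?_)
  filter_upwards [hR] with x hx
  simp only [abs_mul, abs_pow, Real.abs_exp, pow_zero, one_mul]
  gcongr

lemma tiltedMoment_zero_le (hR : ∀ᵐ x ∂P, |x| ≤ R) {A : ℝ} (hA : 0 ≤ A) (B : ℝ) :
    tiltedMoment P 0 A B ≤ Real.exp (R * |B|) := by
  have := integral_mono_ae (integrable_tilt hR 0 A B) (integrable_const (Real.exp (R * |B|)))
    (hR.mono fun x hx => by simpa using exp_tilt_le hx hA B)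
  simpa [tiltedMoment] using this

lemma exp_neg_le_tiltedMoment_zero (hR : ∀ᵐ x ∂P, |x| ≤ R) {A : ℝ} (hA : 0 ≤ A) (B : ℝ) :
    Real.exp (-(R * |B| + A * R ^ 2 / 2)) ≤ tiltedMoment P 0 A B := by
  have := integral_mono_ae (integrable_const (Real.exp (-(R * |B| + A * R ^ 2 / 2))))
    (integrable_tilt hR 0 A B) (hR.mono fun x hx => ?_)
  · simpa [tiltedMoment] using this
  · have hx2 : x ^ 2 ≤ R ^ 2 := sq_le_sq.2 (hx.trans (le_abs_self R))
    have h1 : -(B * x) ≤ R * |B| := by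
      calc -(B * x) ≤ |B| * |x| := (neg_le_abs _).trans (abs_mul _ _).le
        _ ≤ R * |B| := by rw [mul_comm]; gcongr
    have h2 : A * x ^ 2 ≤ A * R ^ 2 := by gcongr
    simp only [pow_zero, one_mul]
    gcongr
    linarith

lemma abs_log_tiltedMoment_zero_le (hR : ∀ᵐ x ∂P, |x| ≤ R) {A : ℝ} (hA : 0 ≤ A) (B : ℝ) :
    |Real.log (tiltedMoment P 0 A B)| ≤ R * |B| + A * R ^ 2 / 2 := by
  have hpos := tiltedMoment_zero_pos hR A B
  have h1 := (Real.le_log_iff_exp_le hpos).2 (exp_neg_le_tiltedMoment_zero hR hA B)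
  have h2 := (Real.log_le_iff_le_exp hpos).2 (tiltedMoment_zero_le hR hA B)
  have : 0 ≤ A * R ^ 2 := by positivity
  rw [abs_le]
  constructor <;> linarith

lemma hasFDerivAt_tiltedMoment (hR : ∀ᵐ x ∂P, |x| ≤ R) (k : ℕ) (p : ℝ × ℝ) :
    HasFDerivAt (fun p : ℝ × ℝ => tiltedMoment P k p.1 p.2)
      (tiltedMoment P (k + 1) p.1 p.2 • ContinuousLinearMap.snd ℝ ℝ ℝ
        - (tiltedMoment P (k + 2) p.1 p.2 / 2) • ContinuousLinearMap.fst ℝ ℝ ℝ) p := by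
  set e : ℕ → ℝ × ℝ → ℝ → ℝ :=
    fun k p x => x ^ k * Real.exp (p.2 * x - p.1 * x ^ 2 / 2) with he
  have hi : ∀ k p, Integrable (e k p) P := fun k p => integrable_tilt hR k p.1 p.2
  have hbd : ∀ x, |x| ≤ R → ∀ k, ∀ q ∈ Metric.ball p 1, |e k q x|
      ≤ R ^ k * Real.exp (R * (|p.2| + 1) + (|p.1| + 1) * R ^ 2 / 2) := by
    intro x hx k q hq
    have hR0 : 0 ≤ R := (abs_nonneg x).trans hx
    have hd : dist q p < 1 := hq
    rw [Prod.dist_eq, max_lt_iff, Real.dist_eq, Real.dist_eq] at hd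
    have h1 : |q.1| ≤ |p.1| + 1 := by
      have := abs_sub_abs_le_abs_sub q.1 p.1
      linarith [hd.1]
    have h2 : |q.2| ≤ |p.2| + 1 := by
      have := abs_sub_abs_le_abs_sub q.2 p.2
      linarith [hd.2]
    refine (abs_pow_mul_exp_le hx k q.1 q.2).trans ?_
    gcongr
  have key := hasFDerivAt_integral_of_dominated_of_fderiv_le (𝕜 := ℝ) (μ := P)
    (F := fun p x => e k p x)
    (F' := fun p x => e (k + 1) p x • ContinuousLinearMap.snd ℝ ℝ ℝ
      - (e (k + 2) p x / 2) • ContinuousLinearMap.fst ℝ ℝ ℝ)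
    (x₀ := p) (s := Metric.ball p 1)
    (bound := fun _ => R ^ (k + 1) * Real.exp (R * (|p.2| + 1) + (|p.1| + 1) * R ^ 2 / 2)
      + R ^ (k + 2) * Real.exp (R * (|p.2| + 1) + (|p.1| + 1) * R ^ 2 / 2) / 2)
    (Metric.ball_mem_nhds _ one_pos)
    (.of_forall fun q => (hi k q).aestronglyMeasurable) (hi k p)
    (((hi (k + 1) p).smul_const _).sub
      (((hi (k + 2) p).div_const 2).smul_const _)).aestronglyMeasurable
    ?_ (integrable_const _) ?_
  · refine key.congr_fderiv ?_
    rw [integral_sub ((hi (k + 1) p).smul_const _) (((hi (k + 2) p).div_const 2).smul_const _),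
      integral_smul_const, integral_smul_const, integral_div]
    rfl
  · filter_upwards [hR] with x hx q hq
    refine (norm_sub_le _ _).trans (add_le_add ?_ ?_)
    · rw [norm_smul]
      exact (mul_le_of_le_one_right (norm_nonneg _) (ContinuousLinearMap.norm_snd_le ℝ ℝ ℝ)).trans
        (hbd x hx _ q hq)
    · rw [norm_smul]
      refine (mul_le_of_le_one_right (norm_nonneg _)
        (ContinuousLinearMap.norm_fst_le ℝ ℝ ℝ)).trans ?_
      rw [Real.norm_eq_abs, abs_div, abs_two]
      have := hbd x hx (k + 2) q hq
      gcongr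
  · refine ae_of_all _ fun x q _ => ?_
    have h1 : HasFDerivAt (fun q : ℝ × ℝ => q.2 * x - q.1 * x ^ 2 / 2)
        (x • ContinuousLinearMap.snd ℝ ℝ ℝ - (x ^ 2 / 2) • ContinuousLinearMap.fst ℝ ℝ ℝ) q := by
      have := (x • ContinuousLinearMap.snd ℝ ℝ ℝ
        - (x ^ 2 / 2) • ContinuousLinearMap.fst ℝ ℝ ℝ).hasFDerivAt (x := q)
      refine this.congr_of_eventuallyEq (.of_forall fun q => ?_)
      simp
      ring
    refine (h1.exp.const_mul (x ^ k)).congr_fderiv ?_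
    ext <;> simp [he] <;> ring

lemma continuous_tiltedMoment (hR : ∀ᵐ x ∂P, |x| ≤ R) (k : ℕ) :
    Continuous (fun p : ℝ × ℝ => tiltedMoment P k p.1 p.2) :=
  continuous_iff_continuousAt.2 fun p => (hasFDerivAt_tiltedMoment hR k p).continuousAt

lemma hasDerivAt_tiltedMoment (hR : ∀ᵐ x ∂P, |x| ≤ R) (k : ℕ) {a b : ℝ → ℝ} {a' b' t : ℝ}
    (ha : HasDerivAt a a' t) (hb : HasDerivAt b b' t) :
    HasDerivAt (fun t => tiltedMoment P k (a t) (b t))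
      (tiltedMoment P (k + 1) (a t) (b t) * b' - tiltedMoment P (k + 2) (a t) (b t) / 2 * a') t :=
  ((hasFDerivAt_tiltedMoment hR k (a t, b t)).comp_hasDerivAt_of_eq t (ha.prodMk hb)
    rfl).congr_deriv (by simp)

end Moments

section Planted

variable {P : Measure ℝ} [IsProbabilityMeasure P] {R : ℝ}

lemma mul_add_le_mul_exp {a b t : ℝ} (ha : 0 ≤ a) (hb : 0 ≤ b) (ht : 0 ≤ t) :
    a * t + b ≤ (a + b) * Real.exp t := by
  have h1 : t ≤ Real.exp t := by linarith [Real.add_one_le_exp t]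
  have h2 : 1 ≤ Real.exp t := Real.one_le_exp ht
  nlinarith [mul_le_mul_of_nonneg_left h1 ha, mul_le_mul_of_nonneg_left h2 hb]

lemma nonneg_of_ae_abs_le (hR : ∀ᵐ x ∂P, |x| ≤ R) : 0 ≤ R :=
  let ⟨x, hx⟩ := hR.exists
  (abs_nonneg x).trans hx

/-- Averaging over the planted signal and the Gaussian channel is the same as averaging over pure
noise with the likelihood ratio as density. -/
lemma integral_planted_eq (hR : ∀ᵐ x ∂P, |x| ≤ R) {y : ℝ} (hy : 0 ≤ y) {h : ℝ → ℝ}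
    (hc : Continuous h) {C c : ℝ} (hb : ∀ B, |h B| ≤ C * Real.exp (c * |B|)) (k : ℕ) :
    ∫ x₀, ∫ w, x₀ ^ k * h (y * x₀ + √y * w) ∂(gaussianReal 0 1) ∂P
      = ∫ w, h (√y * w) * tiltedMoment P k y (√y * w) ∂(gaussianReal 0 1) := by
  have hsq : √y * √y = y := Real.mul_self_sqrt hy
  have h1 : ∀ x₀ : ℝ, ∫ w, x₀ ^ k * h (y * x₀ + √y * w) ∂(gaussianReal 0 1)
      = ∫ w, h (√y * w) * (x₀ ^ k * Real.exp (√y * w * x₀ - y * x₀ ^ 2 / 2))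
          ∂(gaussianReal 0 1) := by
    intro x₀
    have := integral_comp_add_gaussianReal (fun w => x₀ ^ k * h (√y * w)) (√y * x₀)
    convert this using 3 with w w
    · congr 2
      linear_combination (-x₀) * hsq
    · have : √y * w * x₀ - y * x₀ ^ 2 / 2 = √y * x₀ * w - (√y * x₀) ^ 2 / 2 := by
        linear_combination (x₀ ^ 2 / 2) * hsq
      rw [this]
      ring
  simp_rw [h1]
  rw [integral_integral_swap]
  · simp_rw [integral_const_mul]
    rfl
  · have hbound := ((integrable_exp_mul_abs_gaussianReal (c * √y + R * √y)).const_mul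
      (C * R ^ k)).comp_snd P
    refine hbound.mono' (Continuous.aestronglyMeasurable ?_) ?_
    · simp only [Function.uncurry_def]
      fun_prop
    · filter_upwards [Measure.quasiMeasurePreserving_fst.ae hR] with p hp
      have e1 := hb (√y * p.2)
      have e2 := exp_tilt_le hp hy (√y * p.2)
      rw [abs_mul, abs_of_nonneg (Real.sqrt_nonneg y)] at e1 e2
      have e3 : |p.1| ^ k ≤ R ^ k := by gcongr
      have hR0 := nonneg_of_ae_abs_le hR
      simp only [Function.uncurry_def, Real.norm_eq_abs, abs_mul, abs_pow, Real.abs_exp]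
      calc |h (√y * p.2)| * (|p.1| ^ k * Real.exp (√y * p.2 * p.1 - y * p.1 ^ 2 / 2))
          ≤ (C * Real.exp (c * (√y * |p.2|))) * (R ^ k * Real.exp (R * (√y * |p.2|))) :=
            mul_le_mul e1 (by gcongr) (by positivity) ((abs_nonneg _).trans e1)
        _ = C * R ^ k * (Real.exp (c * (√y * |p.2|)) * Real.exp (R * (√y * |p.2|))) := by ring
        _ = C * R ^ k * Real.exp ((c * √y + R * √y) * |p.2|) := by
            rw [← Real.exp_add]
            congr 2
            ring

lemma abs_sqrt_mul_le {y b : ℝ} (hyb : y ≤ b) (w : ℝ) : |√y * w| ≤ √b * |w| := by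
  rw [abs_mul, abs_of_nonneg (Real.sqrt_nonneg y)]
  gcongr

lemma tiltedMoment_zero_sqrt_le (hR : ∀ᵐ x ∂P, |x| ≤ R) {y b : ℝ} (hy : 0 ≤ y) (hyb : y ≤ b)
    (w : ℝ) : tiltedMoment P 0 y (√y * w) ≤ Real.exp (R * √b * |w|) := by
  refine (tiltedMoment_zero_le hR hy _).trans (Real.exp_le_exp.2 ?_)
  rw [mul_assoc]
  exact mul_le_mul_of_nonneg_left (abs_sqrt_mul_le hyb w) (nonneg_of_ae_abs_le hR)

lemma abs_log_tiltedMoment_zero_sqrt_le (hR : ∀ᵐ x ∂P, |x| ≤ R) {y b : ℝ} (hy : 0 ≤ y)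
    (hyb : y ≤ b) (w : ℝ) :
    |Real.log (tiltedMoment P 0 y (√y * w))| ≤ R * √b * |w| + b * R ^ 2 / 2 := by
  refine (abs_log_tiltedMoment_zero_le hR hy _).trans ?_
  have := mul_le_mul_of_nonneg_left (abs_sqrt_mul_le hyb w) (nonneg_of_ae_abs_le hR)
  have : y * R ^ 2 ≤ b * R ^ 2 := by gcongr
  linarith

lemma abs_log_mul_tiltedMoment_le (hR : ∀ᵐ x ∂P, |x| ≤ R) {y b : ℝ} (hy : 0 ≤ y)
    (hyb : y ≤ b) (w : ℝ) :
    |Real.log (tiltedMoment P 0 y (√y * w)) * tiltedMoment P 0 y (√y * w)|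
      ≤ (R * √b + b * R ^ 2 / 2) * Real.exp ((R * √b + 1) * |w|) := by
  have hR0 := nonneg_of_ae_abs_le hR
  have hb : 0 ≤ b := hy.trans hyb
  rw [abs_mul, abs_of_pos (tiltedMoment_zero_pos hR _ _)]
  calc _ ≤ ((R * √b + b * R ^ 2 / 2) * Real.exp |w|) * Real.exp (R * √b * |w|) := by
        refine mul_le_mul ((abs_log_tiltedMoment_zero_sqrt_le hR hy hyb w).trans
          (mul_add_le_mul_exp (by positivity) (by positivity) (abs_nonneg w)))
          (tiltedMoment_zero_sqrt_le hR hy hyb w) (tiltedMoment_zero_pos hR _ _).le (by positivity)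
    _ = _ := by
        rw [mul_assoc, ← Real.exp_add]
        ring_nf

lemma abs_tiltedMoment_one_div_zero_le (hR : ∀ᵐ x ∂P, |x| ≤ R) (A B : ℝ) :
    |tiltedMoment P 1 A B / tiltedMoment P 0 A B| ≤ R := by
  have hpos := tiltedMoment_zero_pos hR A B
  rw [abs_div, abs_of_pos hpos, div_le_iff₀ hpos]
  simpa using abs_tiltedMoment_le hR 1 A B

lemma abs_tiltedMoment_sqrt_le (hR : ∀ᵐ x ∂P, |x| ≤ R) (k : ℕ) {y b : ℝ} (hy : 0 ≤ y)
    (hyb : y ≤ b) (w : ℝ) :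
    |tiltedMoment P k y (√y * w)| ≤ R ^ k * Real.exp (R * √b * |w|) := by
  have hR0 := nonneg_of_ae_abs_le hR
  refine (abs_tiltedMoment_le hR k _ _).trans ?_
  have := tiltedMoment_zero_sqrt_le hR hy hyb w
  gcongr

lemma abs_div_mul_tiltedMoment_one_le (hR : ∀ᵐ x ∂P, |x| ≤ R) {y b : ℝ} (hy : 0 ≤ y)
    (hyb : y ≤ b) (w : ℝ) :
    |tiltedMoment P 1 y (√y * w) / tiltedMoment P 0 y (√y * w) * tiltedMoment P 1 y (√y * w)|
      ≤ R ^ 2 * Real.exp (R * √b * |w|) := by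
  rw [abs_mul, pow_two, mul_assoc]
  refine mul_le_mul (abs_tiltedMoment_one_div_zero_le hR _ _) ?_ (abs_nonneg _)
    (nonneg_of_ae_abs_le hR)
  simpa using abs_tiltedMoment_sqrt_le hR 1 hy hyb w

lemma continuousOn_integral_gaussianReal_sqrt {H : ℝ → ℝ → ℝ}
    (hH : Continuous fun p : ℝ × ℝ => H p.1 p.2) {b C c : ℝ}
    (hb : ∀ y, 0 ≤ y → y ≤ b → ∀ w, |H y (√y * w)| ≤ C * Real.exp (c * |w|)) :
    ContinuousOn (fun y => ∫ w, H y (√y * w) ∂(gaussianReal 0 1)) (Set.Icc 0 b) := by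
  refine continuousOn_of_dominated (bound := fun w => C * Real.exp (c * |w|)) (fun y _ => ?_)
    (fun y hy => ae_of_all _ (hb y hy.1 hy.2))
    ((integrable_exp_mul_abs_gaussianReal c).const_mul C) (ae_of_all _ fun w => ?_)
  · exact (hH.comp (f := fun w : ℝ => (y, √y * w)) (by fun_prop)).aestronglyMeasurable
  · exact (hH.comp (f := fun y : ℝ => (y, √y * w)) (by fun_prop)).continuousOn

lemma continuous_log_tiltedMoment_zero (hR : ∀ᵐ x ∂P, |x| ≤ R) :
    Continuous fun p : ℝ × ℝ => Real.log (tiltedMoment P 0 p.1 p.2) :=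
  (continuous_tiltedMoment hR 0).log fun p => (tiltedMoment_zero_pos hR p.1 p.2).ne'

lemma continuous_tiltedMoment_one_div_zero (hR : ∀ᵐ x ∂P, |x| ≤ R) :
    Continuous fun p : ℝ × ℝ => tiltedMoment P 1 p.1 p.2 / tiltedMoment P 0 p.1 p.2 :=
  (continuous_tiltedMoment hR 1).div (continuous_tiltedMoment hR 0)
    fun p => (tiltedMoment_zero_pos hR p.1 p.2).ne'

lemma integral_log_Zfun_planted (hR : ∀ᵐ x ∂P, |x| ≤ R) {y : ℝ} (hy : 0 ≤ y) :
    ∫ x₀, ∫ w, Real.log (Zfun P y (y * x₀ + √y * w)) ∂(gaussianReal 0 1) ∂P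
      = ∫ w, Real.log (tiltedMoment P 0 y (√y * w)) * tiltedMoment P 0 y (√y * w)
          ∂(gaussianReal 0 1) := by
  have hR0 := nonneg_of_ae_abs_le hR
  rw [← integral_planted_eq hR hy (h := fun B => Real.log (tiltedMoment P 0 y B))
    ((continuous_log_tiltedMoment_zero hR).comp (f := fun B : ℝ => (y, B)) (by fun_prop))
    (C := R + y * R ^ 2 / 2) (c := 1) (fun B => ?_) 0]
  · simp [Zfun_eq_tiltedMoment]
  · rw [one_mul]
    exact (abs_log_tiltedMoment_zero_le hR hy B).trans
      (mul_add_le_mul_exp hR0 (by positivity) (abs_nonneg B))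

lemma fSE_eq_integral (hR : ∀ᵐ x ∂P, |x| ≤ R) {y : ℝ} (hy : 0 ≤ y) :
    fSE P y = ∫ w, tiltedMoment P 1 y (√y * w) / tiltedMoment P 0 y (√y * w)
      * tiltedMoment P 1 y (√y * w) ∂(gaussianReal 0 1) := by
  rw [← integral_planted_eq hR hy (h := fun B => tiltedMoment P 1 y B / tiltedMoment P 0 y B)
    ((continuous_tiltedMoment_one_div_zero hR).comp (f := fun B : ℝ => (y, B)) (by fun_prop))
    (C := R) (c := 0) (fun B => by simpa using abs_tiltedMoment_one_div_zero_le hR y B) 1]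
  simp [fSE, fIn_eq_tiltedMoment]

lemma hasDerivAt_log_mul_tiltedMoment (hR : ∀ᵐ x ∂P, |x| ≤ R) {y : ℝ} (hy : 0 < y) (w : ℝ) :
    HasDerivAt
      (fun t => Real.log (tiltedMoment P 0 t (√t * w)) * tiltedMoment P 0 t (√t * w))
      ((Real.log (tiltedMoment P 0 y (√y * w)) + 1)
        * (w * tiltedMoment P 1 y (√y * w) / (2 * √y) - tiltedMoment P 2 y (√y * w) / 2)) y := by
  have hpos := tiltedMoment_zero_pos hR y (√y * w)
  have hM := hasDerivAt_tiltedMoment hR 0 (hasDerivAt_id y)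
    ((Real.hasDerivAt_sqrt hy.ne').mul_const w)
  simp only [id, zero_add, mul_one] at hM
  refine ((hM.log hpos.ne').mul hM).congr_deriv ?_
  have : √y ≠ 0 := (Real.sqrt_pos.2 hy).ne'
  field_simp
  ring

/-- The I-MMSE relation: the derivative of the mean log-partition function is half the overlap. -/
lemma hasDerivAt_integral_log_mul_tiltedMoment (hR : ∀ᵐ x ∂P, |x| ≤ R) {y : ℝ} (hy : 0 < y) :
    HasDerivAt
      (fun t => ∫ w, Real.log (tiltedMoment P 0 t (√t * w)) * tiltedMoment P 0 t (√t * w)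
        ∂(gaussianReal 0 1))
      (fSE P y / 2) y := by
  have hR0 := nonneg_of_ae_abs_le hR
  have hcm : ∀ k t, Continuous fun w : ℝ => tiltedMoment P k t (√t * w) := fun k t =>
    (continuous_tiltedMoment hR k).comp (f := fun w : ℝ => (t, √t * w)) (by fun_prop)
  have hcl : ∀ t, Continuous fun w : ℝ => Real.log (tiltedMoment P 0 t (√t * w)) := fun t =>
    (continuous_log_tiltedMoment_zero hR).comp (f := fun w : ℝ => (t, √t * w)) (by fun_prop)
  have hcr : Continuous fun w : ℝ =>
      tiltedMoment P 1 y (√y * w) / tiltedMoment P 0 y (√y * w) :=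
    (continuous_tiltedMoment_one_div_zero hR).comp (f := fun w : ℝ => (y, √y * w)) (by fun_prop)
  have hlog : ∀ t, 0 ≤ t → t ≤ 2 * y → ∀ w, |Real.log (tiltedMoment P 0 t (√t * w)) + 1|
      ≤ (R * √(2 * y) + (y * R ^ 2 + 1)) * Real.exp |w| := by
    intro t ht hty w
    refine le_trans ?_ (mul_add_le_mul_exp (by positivity) (by positivity) (abs_nonneg w))
    refine (abs_add_le _ _).trans ?_
    have := abs_log_tiltedMoment_zero_sqrt_le hR ht hty w
    rw [abs_one]
    linarith
  set K := R * √(2 * y) + (y * R ^ 2 + 1) with hK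
  have hK0 : 0 ≤ K := by positivity
  set c := R * √(2 * y) with hc
  have key := hasDerivAt_integral_of_dominated_loc_of_deriv_le (μ := gaussianReal 0 1)
    (F := fun t w => Real.log (tiltedMoment P 0 t (√t * w)) * tiltedMoment P 0 t (√t * w))
    (F' := fun t w => (Real.log (tiltedMoment P 0 t (√t * w)) + 1)
        * (w * tiltedMoment P 1 t (√t * w) / (2 * √t) - tiltedMoment P 2 t (√t * w) / 2))
    (x₀ := y) (s := Set.Ioo (y / 2) (2 * y))
    (bound := fun w => K * (R / (2 * √(y / 2)) + R ^ 2 / 2) * Real.exp ((c + 2) * |w|))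
    (Ioo_mem_nhds (by linarith) (by linarith))
    (.of_forall fun t => ((hcl t).mul (hcm 0 t)).aestronglyMeasurable)
    (((hcl y).mul (hcm 0 y)).integrable_gaussianReal_of_abs_le
      (abs_log_mul_tiltedMoment_le hR hy.le le_rfl))
    (Continuous.aestronglyMeasurable (by have := hcl y; have := hcm 1 y; have := hcm 2 y; fun_prop))
    (ae_of_all _ fun w t ht => ?_)
    ((integrable_exp_mul_abs_gaussianReal _).const_mul _)
    (ae_of_all _ fun w t ht => hasDerivAt_log_mul_tiltedMoment hR (by linarith [ht.1]) w)
  · refine key.2.congr_deriv ?_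
    have hprod : ∀ k w, |(Real.log (tiltedMoment P 0 y (√y * w)) + 1)
        * tiltedMoment P k y (√y * w)| ≤ K * R ^ k * Real.exp ((c + 1) * |w|) := fun k w => by
      rw [abs_mul]
      calc _ ≤ (K * Real.exp |w|) * (R ^ k * Real.exp (c * |w|)) :=
            mul_le_mul (hlog y hy.le (by linarith) w)
              (abs_tiltedMoment_sqrt_le hR k hy.le (by linarith) w) (abs_nonneg _) (by positivity)
        _ = K * R ^ k * (Real.exp |w| * Real.exp (c * |w|)) := by ring
        _ = _ := by
            rw [← Real.exp_add]
            ring_nf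
    have hI : ∀ k, Integrable (fun w => (Real.log (tiltedMoment P 0 y (√y * w)) + 1)
        * tiltedMoment P k y (√y * w)) (gaussianReal 0 1) := fun k =>
      Continuous.integrable_gaussianReal_of_abs_le
        (by have := hcl y; have := hcm k y; fun_prop) (hprod k)
    have hI1 : Integrable (fun w => (Real.log (tiltedMoment P 0 y (√y * w)) + 1)
        * tiltedMoment P 1 y (√y * w)) (gaussianReal 0 1) := hI 1
    have hI2 : Integrable (fun w => (Real.log (tiltedMoment P 0 y (√y * w)) + 1)
        * tiltedMoment P 2 y (√y * w)) (gaussianReal 0 1) := hI 2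
    have hI3 : Integrable (fun w => w * ((Real.log (tiltedMoment P 0 y (√y * w)) + 1)
        * tiltedMoment P 1 y (√y * w))) (gaussianReal 0 1) := by
      refine Continuous.integrable_gaussianReal_of_abs_le (C := K * R ^ 1) (c := c + 2)
        (by have := hcl y; have := hcm 1 y; fun_prop) fun w => ?_
      rw [abs_mul]
      calc _ ≤ Real.exp |w| * (K * R ^ 1 * Real.exp ((c + 1) * |w|)) :=
            mul_le_mul (by linarith [Real.add_one_le_exp |w|]) (hprod 1 w) (abs_nonneg _)
              (Real.exp_pos _).le
        _ = K * R ^ 1 * (Real.exp |w| * Real.exp ((c + 1) * |w|)) := by ring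
        _ = _ := by
            rw [← Real.exp_add]
            ring_nf
    have hI4 : Integrable (fun w => tiltedMoment P 1 y (√y * w) / tiltedMoment P 0 y (√y * w)
      * tiltedMoment P 1 y (√y * w)) (gaussianReal 0 1) :=
      (hcr.mul (hcm 1 y)).integrable_gaussianReal_of_abs_le
        (abs_div_mul_tiltedMoment_one_le hR hy.le le_rfl)
    have hstein := integral_id_mul_gaussianReal (f' := fun w => √y *
        (tiltedMoment P 1 y (√y * w) / tiltedMoment P 0 y (√y * w) * tiltedMoment P 1 y (√y * w)
          + (Real.log (tiltedMoment P 0 y (√y * w)) + 1) * tiltedMoment P 2 y (√y * w)))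
      (fun w => ?_) hI1 ((hI4.add hI2).const_mul _) hI3
    · have hs : √y ≠ 0 := (Real.sqrt_pos.2 hy).ne'
      rw [integral_const_mul, integral_add hI4 hI2, ← fSE_eq_integral hR hy.le] at hstein
      have : ∀ w, (Real.log (tiltedMoment P 0 y (√y * w)) + 1)
          * (w * tiltedMoment P 1 y (√y * w) / (2 * √y) - tiltedMoment P 2 y (√y * w) / 2)
          = (2 * √y)⁻¹ * (w * ((Real.log (tiltedMoment P 0 y (√y * w)) + 1)
            * tiltedMoment P 1 y (√y * w)))
            - 2⁻¹ * ((Real.log (tiltedMoment P 0 y (√y * w)) + 1)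
            * tiltedMoment P 2 y (√y * w)) := fun w => by field_simp
      simp only [this]
      rw [integral_sub (hI3.const_mul _) (hI2.const_mul _), integral_const_mul, integral_const_mul,
        hstein]
      field_simp
      ring
    · have hpos := tiltedMoment_zero_pos hR y (√y * w)
      have hb : HasDerivAt (fun w : ℝ => √y * w) √y w := by
        simpa using (hasDerivAt_id w).const_mul √y
      have h0 := hasDerivAt_tiltedMoment hR 0 (hasDerivAt_const w y) hb
      have h1 := hasDerivAt_tiltedMoment hR 1 (hasDerivAt_const w y) hb
      simp only [zero_add, mul_zero, sub_zero, Nat.reduceAdd] at h0 h1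
      refine (((h0.log hpos.ne').add_const 1).mul h1).congr_deriv ?_
      field_simp
  · have ht0 : 0 < t := by linarith [ht.1]
    have h1 := abs_tiltedMoment_sqrt_le hR 1 ht0.le ht.2.le w
    have h2 := abs_tiltedMoment_sqrt_le hR 2 ht0.le ht.2.le w
    have hs : √(y / 2) ≤ √t := Real.sqrt_le_sqrt ht.1.le
    have hs0 : 0 < √(y / 2) := Real.sqrt_pos.2 (by linarith)
    rw [Real.norm_eq_abs, abs_mul]
    have h3 : |w * tiltedMoment P 1 t (√t * w) / (2 * √t) - tiltedMoment P 2 t (√t * w) / 2|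
        ≤ (R / (2 * √(y / 2)) + R ^ 2 / 2) * Real.exp |w| * Real.exp (c * |w|) := by
      calc _ ≤ |w * tiltedMoment P 1 t (√t * w) / (2 * √t)| + |tiltedMoment P 2 t (√t * w) / 2| :=
            abs_sub _ _
        _ = |w| * |tiltedMoment P 1 t (√t * w)| / (2 * √t) + |tiltedMoment P 2 t (√t * w)| / 2 := by
            rw [abs_div, abs_div, abs_mul, abs_two, abs_of_nonneg (by positivity : 0 ≤ 2 * √t)]
        _ ≤ |w| * (R ^ 1 * Real.exp (c * |w|)) / (2 * √(y / 2))
            + R ^ 2 * Real.exp (c * |w|) / 2 := by gcongr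
        _ = (R / (2 * √(y / 2)) * |w| + R ^ 2 / 2) * Real.exp (c * |w|) := by ring
        _ ≤ _ := by
            gcongr
            exact mul_add_le_mul_exp (by positivity) (by positivity) (abs_nonneg w)
    calc _ ≤ (K * Real.exp |w|)
          * ((R / (2 * √(y / 2)) + R ^ 2 / 2) * Real.exp |w| * Real.exp (c * |w|)) :=
          mul_le_mul (hlog t ht0.le ht.2.le w) h3 (abs_nonneg _) (by positivity)
      _ = K * (R / (2 * √(y / 2)) + R ^ 2 / 2)
          * (Real.exp |w| * Real.exp |w| * Real.exp (c * |w|)) := by ring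
      _ = _ := by
          rw [← Real.exp_add, ← Real.exp_add]
          ring_nf

end Planted

/-- **Parametric free-energy difference formula** for the rank-one Bayes-optimal
problem: for every `x > 0` with `f^{SE}(x) > 0`, setting `Δ(x) = f^{SE}(x)/x` and
`m(x) = f^{SE}(x)`, one has
`Φ(m(x), Δ(x)) − Φ(0, Δ(x)) = (1/2)·[ ∫₀ˣ f^{SE}(u) du − x·f^{SE}(x)/2 ]`. -/
theorem replica_free_energy_difference
    (P : Measure ℝ) [IsProbabilityMeasure P]
    (K : Set ℝ) (hK : IsCompact K) (hPK : P Kᶜ = 0)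
    (x : ℝ) (hx : 0 < x) (hfx : 0 < fSE P x) :
    replicaPhi P (fSE P x) (fSE P x / x) - replicaPhi P 0 (fSE P x / x)
      = (1 / 2) * ((∫ u in (0 : ℝ)..x, fSE P u) - x * fSE P x / 2) := by
  obtain ⟨R, hKR⟩ := hK.isBounded.exists_norm_le
  have hR : ∀ᵐ x ∂P, |x| ≤ R := by
    have : ∀ᵐ x ∂P, x ∈ K := hPK
    exact this.mono hKR
  have hcont := continuousOn_integral_gaussianReal_sqrt (b := x)
    (H := fun A B => Real.log (tiltedMoment P 0 A B) * tiltedMoment P 0 A B)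
    ((continuous_log_tiltedMoment_zero hR).mul (continuous_tiltedMoment hR 0))
    (fun y hy hyx => abs_log_mul_tiltedMoment_le hR hy hyx)
  have hfSE : ContinuousOn (fSE P) (Set.Icc 0 x) :=
    (continuousOn_integral_gaussianReal_sqrt (b := x)
      (H := fun A B => tiltedMoment P 1 A B / tiltedMoment P 0 A B * tiltedMoment P 1 A B)
      ((continuous_tiltedMoment_one_div_zero hR).mul (continuous_tiltedMoment hR 1))
      (fun y hy hyx => abs_div_mul_tiltedMoment_one_le hR hy hyx)).congr
      fun y hy => fSE_eq_integral hR hy.1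
  have hFTC := intervalIntegral.integral_eq_sub_of_hasDerivAt_of_le hx.le hcont
    (fun y hy => hasDerivAt_integral_log_mul_tiltedMoment hR hy.1)
    ((hfSE.div_const 2).intervalIntegrable_of_Icc hx.le)
  have h0 : ∀ w, tiltedMoment P 0 0 (√0 * w) = 1 := fun w => by simp [tiltedMoment]
  simp only [h0, Real.log_one, zero_mul, integral_zero, sub_zero] at hFTC
  rw [← integral_log_Zfun_planted hR hx.le, intervalIntegral.integral_div] at hFTC
  have hdiv : fSE P x / (fSE P x / x) = x := by field_simp
  have hZ0 : Zfun P 0 0 = 1 := by simp [Zfun]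
  simp only [replicaPhi, hdiv, zero_div, zero_mul, Real.sqrt_zero, add_zero, hZ0, Real.log_one,
    integral_zero, ← hFTC]
  field_simp
  ring
end

section
/- Small-density asymptotics of the dynamical spinodal for the spiked Rademacher–Bernoulli model: define Δ_Dyn(ρ) = sup_{x > 0} f_ρ(x)/x. Then lim_{ρ→0⁺} ( −2·log(ρ)/ρ ) · Δ_Dyn(ρ) = 1; equivalently, Δ_Dyn(ρ) = (1 + o(1)) · ρ / ( −2·log ρ ) as ρ → 0⁺. -/
open MeasureTheory ProbabilityTheory Filter

/-- The Rademacher–Bernoulli state-evolution function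
`f_ρ(x) = ρ · E_W[ tanh(x + W·√x) · ρ / ((1−ρ)·exp(x/2)/cosh(x + W·√x) + ρ) ]`. -/
noncomputable def fRB (ρ x : ℝ) : ℝ :=
  ρ * ∫ w, Real.tanh (x + w * Real.sqrt x) * ρ /
      ((1 - ρ) * Real.exp (x / 2) / Real.cosh (x + w * Real.sqrt x) + ρ)
    ∂(gaussianReal 0 1)

/-- The dynamical spinodal `Δ_Dyn(ρ) = sup_{x > 0} f_ρ(x)/x`. -/
noncomputable def DeltaDyn (ρ : ℝ) : ℝ :=
  sSup ((fun x => fRB ρ x / x) '' Set.Ioi (0 : ℝ))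

/-- The state-evolution integrand as a function of `y = x + w √x`, with `c = (1 - ρ) exp (x / 2)`. -/
noncomputable def spinodalKernel (c ρ y : ℝ) : ℝ :=
  ρ * Real.sinh y / (c + ρ * Real.cosh y)

lemma fRB_eq_integral_spinodalKernel (ρ x : ℝ) :
    fRB ρ x = ρ * ∫ w, spinodalKernel ((1 - ρ) * Real.exp (x / 2)) ρ (x + w * Real.sqrt x)
      ∂(gaussianReal 0 1) := by
  unfold fRB spinodalKernel
  congr 2 with w
  have hc := (Real.cosh_pos (x + w * Real.sqrt x)).ne'
  rw [Real.tanh_eq_sinh_div_cosh, div_add' _ _ _ hc, div_mul_eq_mul_div, div_div_div_cancel_right₀ hc,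
    mul_comm ρ (Real.sinh _)]

lemma continuous_spinodalKernel {c ρ : ℝ} (hc : 0 < c) (hρ : 0 < ρ) :
    Continuous (spinodalKernel c ρ) := by
  unfold spinodalKernel
  refine Continuous.div (by fun_prop) (by fun_prop) fun y => ?_
  have := Real.cosh_pos y
  positivity

lemma abs_spinodalKernel_le_one {c ρ : ℝ} (hc : 0 < c) (hρ : 0 < ρ) (y : ℝ) :
    |spinodalKernel c ρ y| ≤ 1 := by
  have h1 := Real.cosh_pos y
  have h2 : |Real.sinh y| ≤ Real.cosh y := by
    rw [← Real.cosh_abs y, Real.abs_sinh]; exact (Real.sinh_lt_cosh _).le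
  have h3 : 0 < c + ρ * Real.cosh y := by positivity
  rw [spinodalKernel, abs_div, abs_mul, abs_of_pos hρ, abs_of_pos h3, div_le_one h3]
  nlinarith

lemma spinodalKernel_neg (c ρ y : ℝ) : spinodalKernel c ρ (-y) = -spinodalKernel c ρ y := by
  simp [spinodalKernel, neg_div]

lemma integrable_spinodalKernel_comp {c ρ : ℝ} (hc : 0 < c) (hρ : 0 < ρ) (x s : ℝ) :
    Integrable (fun w => spinodalKernel c ρ (x + w * s)) (gaussianReal 0 1) := by
  refine Integrable.of_bound (C := 1) ?_ (ae_of_all _ fun w => abs_spinodalKernel_le_one hc hρ _)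
  exact ((continuous_spinodalKernel hc hρ).comp (by fun_prop)).aestronglyMeasurable

lemma integral_gaussianReal_comp_neg (f : ℝ → ℝ) (hf : Continuous f) :
    ∫ w, f (-w) ∂(gaussianReal 0 1) = ∫ w, f w ∂(gaussianReal 0 1) := by
  have h := gaussianReal_map_neg (μ := 0) (v := 1)
  rw [neg_zero] at h
  conv_rhs => rw [← h]
  rw [integral_map (by fun_prop) hf.aestronglyMeasurable]

lemma integral_gaussianReal_of_odd (f : ℝ → ℝ) (hf : Continuous f) (hodd : ∀ w, f (-w) = -f w) :
    ∫ w, f w ∂(gaussianReal 0 1) = 0 := by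
  have h := integral_gaussianReal_comp_neg f hf
  simp only [hodd, integral_neg] at h
  linarith

lemma integrable_exp_affine_gaussianReal (a b : ℝ) :
    Integrable (fun w => Real.exp (a + b * w)) (gaussianReal 0 1) := by
  simp only [Real.exp_add]
  exact (integrable_exp_mul_gaussianReal b).const_mul _

lemma integral_exp_affine_gaussianReal (a b : ℝ) :
    ∫ w, Real.exp (a + b * w) ∂(gaussianReal 0 1) = Real.exp (a + b ^ 2 / 2) := by
  have h := congrFun (mgf_fun_id_gaussianReal (μ := 0) (v := 1)) b
  simp only [mgf] at h
  simp only [Real.exp_add, integral_const_mul, h]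
  simp

lemma spinodalKernel_add_sub_le {c ρ : ℝ} (hc : 0 < c) (hρ : 0 < ρ) {x : ℝ} (hx : 0 ≤ x) (y : ℝ) :
    spinodalKernel c ρ (x + y) - spinodalKernel c ρ y ≤
      ρ * ((Real.sinh (x + y) - Real.sinh y) / c + ρ * Real.sinh x / c ^ 2) := by
  have h1 := Real.cosh_pos (x + y)
  have h2 := Real.cosh_pos y
  have h3 : 0 ≤ Real.sinh (x + y) - Real.sinh y :=
    sub_nonneg.2 (Real.sinh_le_sinh.2 (by linarith))
  have h4 : 0 ≤ Real.sinh x := Real.sinh_nonneg_iff.2 hx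
  have h5 : Real.sinh x =
      Real.sinh (x + y) * Real.cosh y - Real.cosh (x + y) * Real.sinh y := by
    rw [← Real.sinh_sub]; ring_nf
  have hD : c ≤ c + ρ * Real.cosh (x + y) := by nlinarith
  have hD' : c ≤ c + ρ * Real.cosh y := by nlinarith
  have hDD : c ^ 2 ≤ (c + ρ * Real.cosh (x + y)) * (c + ρ * Real.cosh y) := by
    rw [sq]; exact mul_le_mul hD hD' hc.le (by linarith)
  have key : spinodalKernel c ρ (x + y) - spinodalKernel c ρ y =
      ρ * (c * (Real.sinh (x + y) - Real.sinh y) + ρ * Real.sinh x) /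
        ((c + ρ * Real.cosh (x + y)) * (c + ρ * Real.cosh y)) := by
    rw [h5, spinodalKernel, spinodalKernel, div_sub_div _ _ (by positivity) (by positivity)]
    ring
  rw [key]
  calc _ ≤ ρ * (c * (Real.sinh (x + y) - Real.sinh y) + ρ * Real.sinh x) / c ^ 2 := by
        gcongr
    _ = _ := by field_simp

lemma integrable_sinh_affine_gaussianReal (x s : ℝ) :
    Integrable (fun w => Real.sinh (x + w * s)) (gaussianReal 0 1) := by
  have h := ((integrable_exp_affine_gaussianReal x s).sub
    (integrable_exp_affine_gaussianReal (-x) (-s))).div_const 2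
  refine h.congr (ae_of_all _ fun w => ?_)
  simp only [Real.sinh_eq, Pi.sub_apply]
  ring_nf

lemma integral_sinh_affine_gaussianReal (x s : ℝ) :
    ∫ w, Real.sinh (x + w * s) ∂(gaussianReal 0 1) = Real.exp (s ^ 2 / 2) * Real.sinh x := by
  have h : ∀ w, Real.sinh (x + w * s) = (Real.exp (x + s * w) - Real.exp (-x + (-s) * w)) / 2 := by
    intro w
    rw [Real.sinh_eq]; ring_nf
  simp only [h]
  rw [integral_div, integral_sub (integrable_exp_affine_gaussianReal _ _)
    (integrable_exp_affine_gaussianReal _ _), integral_exp_affine_gaussianReal,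
    integral_exp_affine_gaussianReal, Real.sinh_eq, Real.exp_add, Real.exp_add]
  ring_nf

lemma integral_spinodalKernel_le_sinh {c ρ x : ℝ} (hc : 0 < c) (hρ : 0 < ρ) (hx : 0 ≤ x) :
    ∫ w, spinodalKernel c ρ (x + w * Real.sqrt x) ∂(gaussianReal 0 1) ≤
      ρ * (Real.exp (x / 2) * Real.sinh x / c + ρ * Real.sinh x / c ^ 2) := by
  have hi0 : Integrable (fun w => spinodalKernel c ρ (w * Real.sqrt x)) (gaussianReal 0 1) := by
    simpa using integrable_spinodalKernel_comp hc hρ 0 (Real.sqrt x)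
  have hi1 := integrable_spinodalKernel_comp hc hρ x (Real.sqrt x)
  have hs0 : Integrable (fun w => Real.sinh (w * Real.sqrt x)) (gaussianReal 0 1) := by
    simpa using integrable_sinh_affine_gaussianReal 0 (Real.sqrt x)
  have hs1 := integrable_sinh_affine_gaussianReal x (Real.sqrt x)
  have hz : ∫ w, spinodalKernel c ρ (w * Real.sqrt x) ∂(gaussianReal 0 1) = 0 :=
    integral_gaussianReal_of_odd _ ((continuous_spinodalKernel hc hρ).comp (by fun_prop))
      fun w => by rw [neg_mul, spinodalKernel_neg]
  have hsz : ∫ w, Real.sinh (w * Real.sqrt x) ∂(gaussianReal 0 1) = 0 := by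
    simpa using integral_sinh_affine_gaussianReal 0 (Real.sqrt x)
  have hds : Integrable (fun w => (Real.sinh (x + w * Real.sqrt x) -
      Real.sinh (w * Real.sqrt x)) / c) (gaussianReal 0 1) := (hs1.sub hs0).div_const c
  have hmono := integral_mono (hi1.sub hi0)
    ((hds.add (integrable_const (ρ * Real.sinh x / c ^ 2))).const_mul ρ)
    fun w => spinodalKernel_add_sub_le hc hρ hx (w * Real.sqrt x)
  simp only [Pi.sub_apply, Pi.add_apply] at hmono
  rw [integral_sub hi1 hi0, hz, sub_zero, integral_const_mul,
    integral_add hds (integrable_const _), integral_div, integral_sub hs1 hs0, hsz, sub_zero,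
    integral_sinh_affine_gaussianReal, Real.sq_sqrt hx] at hmono
  simpa using hmono

lemma exp_div_exp_add_exp_le {a b θ : ℝ} (h0 : 0 ≤ θ) (h1 : θ ≤ 1) :
    Real.exp a / (Real.exp a + Real.exp b) ≤ Real.exp (θ * (a - b)) := by
  have ha := Real.exp_pos a
  have hb := Real.exp_pos b
  rcases le_total a b with hab | hab
  · calc _ ≤ Real.exp a / Real.exp b := by gcongr; linarith
      _ = Real.exp (a - b) := (Real.exp_sub _ _).symm
      _ ≤ _ := Real.exp_le_exp.2 (by nlinarith)
  · calc _ ≤ (1 : ℝ) := by rw [div_le_one (by positivity)]; linarith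
      _ ≤ _ := Real.one_le_exp (mul_nonneg h0 (by linarith))

lemma div_add_le_exp_of_le {s t a b θ : ℝ} (hs : 0 < s) (hsa : s ≤ Real.exp a)
    (hbt : Real.exp b ≤ t) (h0 : 0 ≤ θ) (h1 : θ ≤ 1) :
    s / (s + t) ≤ Real.exp (θ * (a - b)) := by
  have hb := Real.exp_pos b
  refine le_trans ?_ (exp_div_exp_add_exp_le h0 h1)
  rw [div_le_div_iff₀ (by linarith) (by positivity)]
  nlinarith [mul_le_mul hsa hbt hb.le (Real.exp_pos a).le]

lemma cosh_le_exp_abs (y : ℝ) : Real.cosh y ≤ Real.exp |y| := by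
  rw [Real.cosh_eq]
  linarith [Real.exp_le_exp.2 (le_abs_self y), Real.exp_le_exp.2 (neg_le_abs y)]

lemma exp_sub_log_two_le_cosh (y : ℝ) : Real.exp (y - Real.log 2) ≤ Real.cosh y := by
  rw [Real.exp_sub, Real.exp_log two_pos, Real.cosh_eq]
  linarith [Real.exp_pos (-y)]

lemma exp_mul_log_two_le_two {θ : ℝ} (h1 : θ ≤ 1) : Real.exp (θ * Real.log 2) ≤ 2 := by
  calc _ ≤ Real.exp (Real.log 2) :=
        Real.exp_le_exp.2 (mul_le_of_le_one_left (Real.log_nonneg one_le_two) h1)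
    _ = 2 := Real.exp_log two_pos

/-- Chernoff-type upper bound, effective below the threshold `x < 2 ℓ`. -/
lemma integral_spinodalKernel_le_exp {c ℓ x θ : ℝ} (hc : Real.exp (x / 2 - Real.log 2) ≤ c)
    (hx : 0 ≤ x) (h0 : 0 ≤ θ) (h1 : θ ≤ 1) :
    ∫ w, spinodalKernel c (Real.exp (-ℓ)) (x + w * Real.sqrt x) ∂(gaussianReal 0 1) ≤
      4 * Real.exp (θ * (-ℓ + x / 2 * (1 + θ))) := by
  have hc0 : 0 < c := (Real.exp_pos _).trans_le hc
  set κ := θ * (Real.log 2 - ℓ - x / 2)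
  have hpt : ∀ w : ℝ, spinodalKernel c (Real.exp (-ℓ)) (x + w * Real.sqrt x) ≤
      Real.exp ((κ + θ * x) + (θ * Real.sqrt x) * w) +
        Real.exp ((κ - θ * x) + (-(θ * Real.sqrt x)) * w) := by
    intro w
    set y := x + w * Real.sqrt x with hy
    have hcosh := Real.cosh_pos y
    have hρ := Real.exp_pos (-ℓ)
    have hs := Real.sinh_lt_cosh y
    calc spinodalKernel c (Real.exp (-ℓ)) y
        ≤ Real.exp (-ℓ) * Real.cosh y / (Real.exp (-ℓ) * Real.cosh y + c) := by
          rw [spinodalKernel, add_comm c]; gcongr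
      _ ≤ Real.exp (θ * ((-ℓ + |y|) - (x / 2 - Real.log 2))) := by
          refine div_add_le_exp_of_le (by positivity) ?_ hc h0 h1
          rw [Real.exp_add]; gcongr; exact cosh_le_exp_abs y
      _ ≤ _ := by
          rcases abs_cases y with ⟨h, -⟩ | ⟨h, -⟩ <;> rw [h, hy]
          · refine le_add_of_le_of_nonneg (Real.exp_le_exp.2 (le_of_eq ?_)) (Real.exp_pos _).le
            ring
          · refine le_add_of_nonneg_of_le (Real.exp_pos _).le (Real.exp_le_exp.2 (le_of_eq ?_))
            ring
  have hmono := integral_mono (integrable_spinodalKernel_comp hc0 (Real.exp_pos (-ℓ)) x _)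
    ((integrable_exp_affine_gaussianReal _ _).add (integrable_exp_affine_gaussianReal _ _)) hpt
  simp only [Pi.add_apply] at hmono
  rw [integral_add (integrable_exp_affine_gaussianReal _ _)
    (integrable_exp_affine_gaussianReal _ _), integral_exp_affine_gaussianReal,
    integral_exp_affine_gaussianReal, neg_sq, mul_pow, Real.sq_sqrt hx] at hmono
  have hlog := exp_mul_log_two_le_two h1
  have hA : Real.exp (κ + θ * x + θ ^ 2 * x / 2) =
      Real.exp (θ * Real.log 2) * Real.exp (θ * (-ℓ + x / 2 * (1 + θ))) := by
    rw [← Real.exp_add]; congr 1; ring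
  have hB : Real.exp (κ - θ * x + θ ^ 2 * x / 2) ≤ Real.exp (κ + θ * x + θ ^ 2 * x / 2) :=
    Real.exp_le_exp.2 (by nlinarith [mul_nonneg h0 hx])
  have := mul_le_mul_of_nonneg_right hlog (Real.exp_pos (θ * (-ℓ + x / 2 * (1 + θ)))).le
  linarith

/-- Chernoff-type lower bound, effective above the threshold `x > 2 ℓ`. -/
lemma le_integral_spinodalKernel {c ℓ x θ : ℝ} (hc0 : 0 < c) (hc : c ≤ Real.exp (x / 2))
    (hx : 0 ≤ x) (h0 : 0 ≤ θ) (h1 : θ ≤ 1) :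
    1 - 2 * Real.exp (θ * (ℓ - x / 2 * (1 - θ))) - Real.exp (-x / 2) ≤
      ∫ w, spinodalKernel c (Real.exp (-ℓ)) (x + w * Real.sqrt x) ∂(gaussianReal 0 1) := by
  set κ := θ * (x / 2 + ℓ + Real.log 2 - x)
  have hpt : ∀ w : ℝ, 1 - Real.exp (κ + (-(θ * Real.sqrt x)) * w) -
      Real.exp (-x + (-Real.sqrt x) * w) ≤
        spinodalKernel c (Real.exp (-ℓ)) (x + w * Real.sqrt x) := by
    intro w
    set y := x + w * Real.sqrt x with hy
    have hcosh := Real.cosh_pos y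
    have hρ := Real.exp_pos (-ℓ)
    have hD : 0 < c + Real.exp (-ℓ) * Real.cosh y := by positivity
    have e1 : c / (c + Real.exp (-ℓ) * Real.cosh y) ≤
        Real.exp (κ + (-(θ * Real.sqrt x)) * w) := by
      calc _ ≤ Real.exp (θ * (x / 2 - (-ℓ + (y - Real.log 2)))) := by
            refine div_add_le_exp_of_le hc0 hc ?_ h0 h1
            rw [Real.exp_add]; gcongr; exact exp_sub_log_two_le_cosh y
        _ = _ := by rw [hy]; congr 1; ring
    have e2 : Real.exp (-ℓ) * Real.exp (-y) / (c + Real.exp (-ℓ) * Real.cosh y) ≤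
        Real.exp (-x + (-Real.sqrt x) * w) := by
      have : -x + (-Real.sqrt x) * w = -y := by rw [hy]; ring
      rw [this, div_le_iff₀ hD]
      have := mul_le_mul_of_nonneg_left (Real.one_le_cosh y)
        (mul_pos hρ (Real.exp_pos (-y))).le
      nlinarith [mul_pos hc0 (Real.exp_pos (-y))]
    have e3 : spinodalKernel c (Real.exp (-ℓ)) y =
        1 - c / (c + Real.exp (-ℓ) * Real.cosh y) -
          Real.exp (-ℓ) * Real.exp (-y) / (c + Real.exp (-ℓ) * Real.cosh y) := by
      rw [spinodalKernel, ← Real.cosh_sub_sinh y]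
      field_simp
      ring
    linarith
  have hi1 := integrable_exp_affine_gaussianReal κ (-(θ * Real.sqrt x))
  have hi2 := integrable_exp_affine_gaussianReal (-x) (-Real.sqrt x)
  have hi3 : Integrable (fun w => 1 - Real.exp (κ + (-(θ * Real.sqrt x)) * w))
      (gaussianReal 0 1) := (integrable_const (1 : ℝ)).sub hi1
  have hmono := integral_mono (hi3.sub hi2)
    (integrable_spinodalKernel_comp hc0 (Real.exp_pos (-ℓ)) x _) hpt
  simp only [Pi.sub_apply] at hmono
  rw [integral_sub hi3 hi2, integral_sub (integrable_const (1 : ℝ)) hi1, integral_exp_affine_gaussianReal,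
    integral_exp_affine_gaussianReal, neg_sq, neg_sq, mul_pow, Real.sq_sqrt hx] at hmono
  have hlog := exp_mul_log_two_le_two h1
  have hA : Real.exp (κ + θ ^ 2 * x / 2) =
      Real.exp (θ * Real.log 2) * Real.exp (θ * (ℓ - x / 2 * (1 - θ))) := by
    rw [← Real.exp_add]; congr 1; ring
  have hB : -x + x / 2 = -x / 2 := by ring
  have := mul_le_mul_of_nonneg_right hlog (Real.exp_pos (θ * (ℓ - x / 2 * (1 - θ)))).le
  simp only [integral_const, probReal_univ, smul_eq_mul, mul_one, hA, hB] at hmono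
  linarith

lemma integral_spinodalKernel_le_one {c ρ : ℝ} (hc : 0 < c) (hρ : 0 < ρ) (x s : ℝ) :
    ∫ w, spinodalKernel c ρ (x + w * s) ∂(gaussianReal 0 1) ≤ 1 := by
  simpa using integral_mono (integrable_spinodalKernel_comp hc hρ x s) (integrable_const (1 : ℝ))
    fun w => (abs_le.1 (abs_spinodalKernel_le_one hc hρ _)).2

lemma sinh_le_two_mul {x : ℝ} (h0 : 0 ≤ x) (h1 : x ≤ 1) : Real.sinh x ≤ 2 * x := by
  have h := (abs_le.1 (Real.abs_exp_sub_one_sub_id_le (abs_le.2 ⟨by linarith, h1⟩))).2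
  have h' := Real.add_one_le_exp (-x)
  rw [Real.sinh_eq]
  nlinarith

lemma fRB_div_le {ℓ ε x : ℝ} (hℓ : Real.exp (-ℓ) ≤ 1 / 2) (hℓ0 : 0 < ℓ) (hε0 : 0 < ε) (hε1 : ε < 1)
    (hsmall : 12 * (2 * ℓ) * Real.exp (-ℓ) ≤ 1)
    (hmid : 4 * (2 * ℓ) * Real.exp (-(ε ^ 3 * ℓ)) ≤ 1) (hx : 0 < x) :
    fRB (Real.exp (-ℓ)) x / x ≤ Real.exp (-ℓ) * (1 / ((1 - ε) * (2 * ℓ))) := by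
  have hρ := Real.exp_pos (-ℓ)
  rw [fRB_eq_integral_spinodalKernel, mul_div_assoc]
  set c := (1 - Real.exp (-ℓ)) * Real.exp (x / 2) with hcdef
  have hex : 1 ≤ Real.exp (x / 2) := Real.one_le_exp (by linarith)
  have hchalf : Real.exp (x / 2) / 2 ≤ c := by rw [hcdef]; nlinarith
  have hc : Real.exp (x / 2 - Real.log 2) ≤ c := by
    rwa [Real.exp_sub, Real.exp_log two_pos]
  have hc0 : 0 < c := (Real.exp_pos _).trans_le hc
  have hε' : 0 < 1 - ε := by linarith
  have hfinal : 1 / (2 * ℓ) ≤ 1 / ((1 - ε) * (2 * ℓ)) :=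
    one_div_le_one_div_of_le (by positivity) (by nlinarith)
  refine mul_le_mul_of_nonneg_left ?_ hρ.le
  rcases le_total x 1 with hx1 | hx1
  · refine le_trans ?_ hfinal
    have h := integral_spinodalKernel_le_sinh hc0 hρ hx.le
    have hs := sinh_le_two_mul hx.le hx1
    have hs0 : 0 ≤ Real.sinh x := Real.sinh_nonneg_iff.2 hx.le
    have b1 : Real.exp (x / 2) * Real.sinh x / c ≤ 2 * Real.sinh x := by
      rw [div_le_iff₀ hc0]; nlinarith
    have b2 : Real.exp (-ℓ) * Real.sinh x / c ^ 2 ≤ 4 * Real.sinh x := by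
      rw [div_le_iff₀ (by positivity)]
      have : 1 / 2 ≤ c := by linarith
      have : 1 / 4 ≤ c ^ 2 := by nlinarith
      nlinarith
    rw [div_le_div_iff₀ hx (by positivity), one_mul]
    have h12 := h.trans (mul_le_mul_of_nonneg_left
      (show _ ≤ 12 * x by linarith [b1, b2, hs]) hρ.le)
    calc _ ≤ Real.exp (-ℓ) * (12 * x) * (2 * ℓ) := by gcongr
      _ = (12 * (2 * ℓ) * Real.exp (-ℓ)) * x := by ring
      _ ≤ 1 * x := by gcongr
      _ = x := one_mul x
  rcases le_total x ((1 - ε) * (2 * ℓ)) with hx2 | hx2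
  · refine le_trans ?_ hfinal
    have h := integral_spinodalKernel_le_exp (ℓ := ℓ) hc hx.le hε0.le hε1.le
    have he : Real.exp (ε * (-ℓ + x / 2 * (1 + ε))) ≤ Real.exp (-(ε ^ 3 * ℓ)) := by
      refine Real.exp_le_exp.2 ?_
      have : x / 2 * (1 + ε) ≤ (1 - ε) * ℓ * (1 + ε) := by gcongr; linarith
      nlinarith
    rw [div_le_div_iff₀ hx (by positivity), one_mul]
    calc _ ≤ (4 * Real.exp (-(ε ^ 3 * ℓ))) * (2 * ℓ) := by gcongr; linarith
      _ ≤ 1 := by linarith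
      _ ≤ x := hx1
  · exact div_le_div₀ zero_le_one (integral_spinodalKernel_le_one hc0 hρ _ _) (by positivity) hx2

lemma le_fRB_div {ℓ ε : ℝ} (hℓ0 : 0 < ℓ) (hε0 : 0 < ε) (hε1 : ε ≤ 1 / 2) :
    Real.exp (-ℓ) * ((1 - 2 * Real.exp (-(ε ^ 2 / 8 * ℓ)) - Real.exp (-ℓ)) /
        ((1 + ε) * (2 * ℓ))) ≤
      fRB (Real.exp (-ℓ)) ((1 + ε) * (2 * ℓ)) / ((1 + ε) * (2 * ℓ)) := by
  have hρ := Real.exp_pos (-ℓ)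
  have hρ1 : Real.exp (-ℓ) < 1 := Real.exp_lt_one_iff.2 (by linarith)
  rw [fRB_eq_integral_spinodalKernel, mul_div_assoc]
  set x := (1 + ε) * (2 * ℓ) with hxdef
  have hx : 0 < x := by positivity
  have h := le_integral_spinodalKernel (ℓ := ℓ) (θ := ε / 2)
    (mul_pos (sub_pos.2 hρ1) (Real.exp_pos (x / 2)))
    (mul_le_of_le_one_left (Real.exp_pos (x / 2)).le (by linarith)) hx.le (by linarith) (by linarith)
  refine mul_le_mul_of_nonneg_left (div_le_div_of_nonneg_right (le_trans ?_ h) hx.le) hρ.le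
  have e1 : Real.exp (ε / 2 * (ℓ - x / 2 * (1 - ε / 2))) ≤ Real.exp (-(ε ^ 2 / 8 * ℓ)) := by
    refine Real.exp_le_exp.2 ?_
    have : ε / 2 * (ℓ - x / 2 * (1 - ε / 2)) = -(ε ^ 2 / 4 * (1 - ε) * ℓ) := by
      rw [hxdef]; ring
    rw [this]
    have : 0 ≤ ε ^ 2 * ℓ := by positivity
    nlinarith
  have e2 : Real.exp (-x / 2) ≤ Real.exp (-ℓ) := Real.exp_le_exp.2 (by rw [hxdef]; nlinarith)
  linarith

lemma tendsto_mul_exp_neg_mul {k : ℝ} (hk : 0 < k) (C : ℝ) :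
    Tendsto (fun ℓ : ℝ => C * (2 * ℓ) * Real.exp (-(k * ℓ))) atTop (nhds 0) := by
  have h := (tendsto_rpow_mul_exp_neg_mul_atTop_nhds_zero 1 k hk).const_mul (C * 2)
  simp only [Real.rpow_one, mul_zero, neg_mul] at h
  exact h.congr fun ℓ => by ring

/-- The asymptotics in the variable `ℓ = -log ρ`. -/
lemma tendsto_mul_DeltaDyn_exp_neg :
    Tendsto (fun ℓ : ℝ => (2 * ℓ / Real.exp (-ℓ)) * DeltaDyn (Real.exp (-ℓ))) atTop (nhds 1) := by
  have hexp : Tendsto (fun ℓ : ℝ => Real.exp (-ℓ)) atTop (nhds 0) :=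
    Real.tendsto_exp_neg_atTop_nhds_zero
  have hhalf : ∀ᶠ ℓ : ℝ in atTop, Real.exp (-ℓ) ≤ 1 / 2 :=
    hexp.eventually_le_const (by norm_num)
  have hsmall : ∀ᶠ ℓ : ℝ in atTop, 12 * (2 * ℓ) * Real.exp (-ℓ) ≤ 1 := by
    simpa using (tendsto_mul_exp_neg_mul one_pos 12).eventually_le_const zero_lt_one
  have hmid : ∀ ε : ℝ, 0 < ε → ∀ᶠ ℓ : ℝ in atTop, 4 * (2 * ℓ) * Real.exp (-(ε ^ 3 * ℓ)) ≤ 1 :=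
    fun ε hε => (tendsto_mul_exp_neg_mul (pow_pos hε 3) 4).eventually_le_const zero_lt_one
  refine tendsto_order.2 ⟨fun a ha => ?_, fun b hb => ?_⟩
  · obtain ⟨ε, hεa, hε0, hε1⟩ : ∃ ε : ℝ, a < 1 / (1 + ε) ∧ 0 < ε ∧ ε ≤ 1 / 2 := by
      have hcont : Tendsto (fun ε : ℝ => 1 / (1 + ε)) (nhdsWithin 0 (Set.Ioi 0)) (nhds 1) := by
        have : ContinuousAt (fun ε : ℝ => 1 / (1 + ε)) 0 := by
          fun_prop (disch := norm_num)
        simpa [ContinuousAt] using this.tendsto.mono_left nhdsWithin_le_nhds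
      obtain ⟨ε, h1, h2⟩ := ((hcont.eventually_const_lt ha).and
        (Ioc_mem_nhdsGT (show (0 : ℝ) < 1 / 2 by norm_num))).exists
      exact ⟨ε, h1, h2.1, h2.2⟩
    have hlim : Tendsto (fun ℓ : ℝ =>
        (1 - 2 * Real.exp (-(ε ^ 2 / 8 * ℓ)) - Real.exp (-ℓ)) / (1 + ε)) atTop
        (nhds (1 / (1 + ε))) := by
      have h1 : Tendsto (fun ℓ : ℝ => Real.exp (-(ε ^ 2 / 8 * ℓ))) atTop (nhds 0) :=
        hexp.comp (tendsto_id.const_mul_atTop (by positivity))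
      simpa using (((h1.const_mul 2).const_sub 1).sub hexp).div_const (1 + ε)
    filter_upwards [hlim.eventually_const_lt hεa, hhalf, hsmall, hmid ε hε0,
      eventually_gt_atTop 0] with ℓ h1 h2 h3 h4 hℓ
    refine h1.trans_le ?_
    have hx : (1 + ε) * (2 * ℓ) ∈ Set.Ioi (0 : ℝ) := Set.mem_Ioi.2 (by positivity)
    have hbdd : BddAbove ((fun x => fRB (Real.exp (-ℓ)) x / x) '' Set.Ioi (0 : ℝ)) := by
      refine ⟨Real.exp (-ℓ) * (1 / ((1 - ε) * (2 * ℓ))), ?_⟩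
      rintro _ ⟨x, hx, rfl⟩
      exact fRB_div_le h2 hℓ hε0 (by linarith) h3 h4 hx
    have hle := (le_fRB_div hℓ hε0 hε1).trans (le_csSup hbdd ⟨_, hx, rfl⟩)
    have hm := mul_le_mul_of_nonneg_left hle
      (show 0 ≤ 2 * ℓ / Real.exp (-ℓ) by positivity)
    refine le_trans (le_of_eq ?_) hm
    field_simp
  · obtain ⟨ε, hεb, hε0, hε1⟩ : ∃ ε : ℝ, 1 / (1 - ε) < b ∧ 0 < ε ∧ ε ≤ 1 / 2 := by
      have hcont : Tendsto (fun ε : ℝ => 1 / (1 - ε)) (nhdsWithin 0 (Set.Ioi 0)) (nhds 1) := by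
        have : ContinuousAt (fun ε : ℝ => 1 / (1 - ε)) 0 := by
          fun_prop (disch := norm_num)
        simpa [ContinuousAt] using this.tendsto.mono_left nhdsWithin_le_nhds
      obtain ⟨ε, h1, h2⟩ := ((hcont.eventually_lt_const hb).and
        (Ioc_mem_nhdsGT (show (0 : ℝ) < 1 / 2 by norm_num))).exists
      exact ⟨ε, h1, h2.1, h2.2⟩
    filter_upwards [hhalf, hsmall, hmid ε hε0, eventually_gt_atTop 0] with ℓ h2 h3 h4 hℓ
    refine lt_of_le_of_lt ?_ hεb
    have hle : DeltaDyn (Real.exp (-ℓ)) ≤ Real.exp (-ℓ) * (1 / ((1 - ε) * (2 * ℓ))) := by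
      refine csSup_le (Set.nonempty_Ioi.image _) ?_
      rintro _ ⟨x, hx, rfl⟩
      exact fRB_div_le h2 hℓ hε0 (by linarith) h3 h4 hx
    have hm := mul_le_mul_of_nonneg_left hle
      (show 0 ≤ 2 * ℓ / Real.exp (-ℓ) by positivity)
    refine hm.trans (le_of_eq ?_)
    have : 1 - ε ≠ 0 := by linarith
    field_simp

/-- **Small-density asymptotics of the dynamical spinodal for the spiked
Rademacher–Bernoulli model**: `Δ_Dyn(ρ) = (1 + o(1)) · ρ / (−2·log ρ)` as `ρ → 0⁺`,
i.e. `lim_{ρ→0⁺} (−2·log(ρ)/ρ) · Δ_Dyn(ρ) = 1`. -/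
theorem dynamical_spinodal_small_density_asymptotics :
    Tendsto (fun ρ : ℝ => (-2 * Real.log ρ / ρ) * DeltaDyn ρ)
      (nhdsWithin 0 (Set.Ioo 0 1)) (nhds 1) := by
  have hlog : Tendsto (fun ρ : ℝ => -Real.log ρ) (nhdsWithin 0 (Set.Ioo 0 1)) atTop :=
    tendsto_neg_atBot_atTop.comp
      (Real.tendsto_log_nhdsGT_zero.mono_left (nhdsWithin_mono _ fun _ h => h.1))
  refine (tendsto_mul_DeltaDyn_exp_neg.comp hlog).congr' ?_
  filter_upwards [self_mem_nhdsWithin] with ρ hρ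
  simp only [Function.comp, neg_neg, Real.exp_log hρ.1]
  ring
end
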